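/- arXiv:2503.17123 — 3 statements merged into one kernel-verified Lean document; each statement's English description precedes it below -/
import Mathlib

section
/- If Ω ≠ 0, then the eigenspace of the blockade Hamiltonian H(Ω) corresponding to its minimal eigenvalue is one-dimensional; that is, H(Ω) has a unique ground state up to scalar multiples. -/
/-- Number of edges `{i,j}` of `G` with both endpoints excited in configuration `n`. -/
def excitedEdgeCount {N : ℕ} (G : SimpleGraph (Fin N)) [DecidableRel G.Adj]
    (n : Fin N → Bool) : ℕ :=
  (Finset.univ.filter fun p : Fin N × Fin N =>
    p.1 < p.2 ∧ G.Adj p.1 p.2 ∧ n p.1 = true ∧ n p.2 = true).card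

/-- The blockade Hamiltonian `H(Ω)` indexed by configurations `n ∈ {0,1}^N`. -/
noncomputable def blockadeH {N : ℕ} (G : SimpleGraph (Fin N)) [DecidableRel G.Adj]
    (Δ : Fin N → ℝ) (U₀ Ω : ℝ) : Matrix (Fin N → Bool) (Fin N → Bool) ℝ :=
  Matrix.of fun n n' =>
    if n = n' then
      U₀ * (excitedEdgeCount G n : ℝ) - ∑ i, Δ i * (if n i = true then (1 : ℝ) else 0)
    else if hammingDist n n' = 1 then Ω else 0

open Matrix in
/-- A real symmetric matrix all of whose eigenvalues are at least `μ` dominates `μ • 1`. -/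
theorem Matrix.IsHermitian.posSemidef_sub_smul_one {ι : Type*} [Fintype ι] [DecidableEq ι]
    {A : Matrix ι ι ℝ} (hA : A.IsHermitian) {μ : ℝ}
    (hmin : ∀ μ' : ℝ, Module.End.HasEigenvalue (Matrix.toLin' A) μ' → μ ≤ μ') :
    (A - μ • (1 : Matrix ι ι ℝ)).PosSemidef := by
  have hB : (A - μ • (1 : Matrix ι ι ℝ)).IsHermitian := by
    refine hA.sub ?_
    simp [Matrix.IsHermitian]
  rw [hB.posSemidef_iff_eigenvalues_nonneg]
  intro i
  have h := hB.mulVec_eigenvectorBasis i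
  have hne : (hB.eigenvectorBasis i : ι → ℝ) ≠ 0 := fun h0 =>
    hB.eigenvectorBasis.orthonormal.ne_zero i (by ext j; exact congrFun h0 j)
  have := hmin (hB.eigenvalues i + μ) (Module.End.hasEigenvalue_of_hasEigenvector
    (x := (hB.eigenvectorBasis i : ι → ℝ)) ⟨by
      rw [Module.End.mem_eigenspace_iff, Matrix.toLin'_apply, add_smul, ← h, sub_mulVec,
        smul_mulVec, one_mulVec, sub_add_cancel], hne⟩)
  simpa using this

open Matrix in
/-- Perron–Frobenius for positive semidefinite matrices: if the off-diagonal entries become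
nonpositive after conjugation by a diagonal matrix of signs, and the nonzero entries connect
all indices, then a kernel vector with a zero entry vanishes. -/
theorem Matrix.PosSemidef.eq_zero_of_mulVec_eq_zero {ι : Type*} [Fintype ι]
    {A : Matrix ι ι ℝ} (hA : A.PosSemidef) {s : ι → ℝ} (hs : ∀ i, s i * s i = 1)
    (hsA : ∀ i j, i ≠ j → s i * A i j * s j ≤ 0)
    (hconn : ∀ i j, Relation.ReflTransGen (fun i j => A i j ≠ 0) i j)
    {v : ι → ℝ} (hv : A *ᵥ v = 0) {i₀ : ι} (hi₀ : v i₀ = 0) : v = 0 := by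
  have hs0 : ∀ i, s i ≠ 0 := fun i h => by simpa [h] using hs i
  have hs1 : ∀ i, |s i| = 1 := fun i => by
    rw [← abs_one, ← sq_eq_sq_iff_abs_eq_abs, sq, hs, one_pow]
  have hexp : ∀ x : ι → ℝ, x ⬝ᵥ (A *ᵥ x) = ∑ i, ∑ j, x i * A i j * x j := fun x => by
    simp only [dotProduct, mulVec, Finset.mul_sum, mul_assoc]
  set w : ι → ℝ := fun i => s i * |v i| with hw
  have hle : w ⬝ᵥ (A *ᵥ w) ≤ v ⬝ᵥ (A *ᵥ v) := by
    rw [hexp, hexp]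
    refine Finset.sum_le_sum fun i _ => Finset.sum_le_sum fun j _ => ?_
    rcases eq_or_ne i j with rfl | hij
    · refine le_of_eq ?_
      calc w i * A i i * w i = (s i * s i) * A i i * (|v i| * |v i|) := by simp only [hw]; ring
        _ = v i * A i i * v i := by rw [hs, abs_mul_abs_self]; ring
    · calc w i * A i j * w j = (s i * A i j * s j) * (|v i| * |v j|) := by simp only [hw]; ring
        _ = -|v i * A i j * v j| := by
          rw [← neg_neg (s i * A i j * s j), ← abs_of_nonpos (hsA i j hij)]
          simp only [abs_mul, hs1]; ring
        _ ≤ v i * A i j * v j := neg_abs_le _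
  have hw0 : A *ᵥ w = 0 := by
    rw [← hA.dotProduct_mulVec_zero_iff]
    refine le_antisymm ?_ (hA.dotProduct_mulVec_nonneg w)
    simpa [hv] using hle
  have hstep : ∀ i j, A i j ≠ 0 → v i = 0 → v j = 0 := by
    intro i j hij hi
    have hsum : ∑ k, s i * A i k * s k * |v k| = 0 := by
      have := congrArg (s i * ·) (congrFun hw0 i)
      simpa [mulVec, dotProduct, Finset.mul_sum, hw, mul_assoc] using this
    have hterm : ∀ k ∈ Finset.univ, s i * A i k * s k * |v k| ≤ 0 := by
      intro k _
      rcases eq_or_ne i k with rfl | hik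
      · simp [hi]
      · exact mul_nonpos_of_nonpos_of_nonneg (hsA i k hik) (abs_nonneg _)
    have := (Finset.sum_eq_zero_iff_of_nonpos hterm).1 hsum j (Finset.mem_univ j)
    simpa [hs0, hij] using this
  funext j
  have hj := hconn i₀ j
  induction hj with
  | refl => exact hi₀
  | tail _ hab ih => exact hstep _ _ hab ih

/-- A relation containing every change of a single coordinate connects all functions on a
finite type. -/
theorem Relation.reflTransGen_of_update {ι : Type*} [Fintype ι] [DecidableEq ι] {β : Type*}
    {r : (ι → β) → (ι → β) → Prop}
    (hr : ∀ f i b, b ≠ f i → r f (Function.update f i b)) (f g : ι → β) :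
    Relation.ReflTransGen r f g := by
  classical
  have h : ∀ S : Finset ι, Relation.ReflTransGen r f (S.piecewise g f) := by
    intro S
    induction S using Finset.induction_on with
    | empty => simpa using Relation.ReflTransGen.refl
    | insert a S _ ih =>
      rw [Finset.piecewise_insert]
      by_cases hb : g a = S.piecewise g f a
      · rwa [hb, Function.update_eq_self]
      · exact ih.tail (hr _ _ _ hb)
  simpa using h Finset.univ

theorem hammingDist_update_of_ne {ι : Type*} [Fintype ι] [DecidableEq ι] {β : Type*}
    [DecidableEq β] (f : ι → β) {i : ι} {b : β} (hb : b ≠ f i) :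
    hammingDist f (Function.update f i b) = 1 := by
  rw [hammingDist, Finset.card_eq_one]
  refine ⟨i, ?_⟩
  ext j
  rcases eq_or_ne j i with rfl | hj
  · simp [hb.symm]
  · simp [hj]

/-- The product of a sign `c` over the excited sites. -/
def excitationSign {N : ℕ} (c : ℝ) (n : Fin N → Bool) : ℝ :=
  ∏ i, if n i = true then c else 1

theorem excitationSign_mul_self {N : ℕ} {c : ℝ} (hc : c * c = 1) (n : Fin N → Bool) :
    excitationSign c n * excitationSign c n = 1 := by
  rw [excitationSign, ← Finset.prod_mul_distrib]
  exact Finset.prod_eq_one fun i _ => by split_ifs <;> simp [hc]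

theorem excitationSign_mul_of_hammingDist_eq_one {N : ℕ} {c : ℝ} (hc : c * c = 1)
    {n n' : Fin N → Bool} (h : hammingDist n n' = 1) :
    excitationSign c n * excitationSign c n' = c := by
  obtain ⟨a, ha⟩ := Finset.card_eq_one.1 h
  have hmem : ∀ i, n i ≠ n' i ↔ i = a := fun i => by
    simpa using Finset.ext_iff.1 ha i
  rw [excitationSign, excitationSign, ← Finset.prod_mul_distrib,
    Finset.prod_eq_single a]
  · have hna := (hmem a).2 rfl
    cases h1 : n a <;> cases h2 : n' a <;> simp_all
  · intro i _ hi
    have hni : n i = n' i := not_not.1 fun h => hi ((hmem i).1 h)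
    rw [hni]
    split_ifs <;> simp [hc]
  · simp

theorem blockadeH_isHermitian {N : ℕ} (G : SimpleGraph (Fin N)) [DecidableRel G.Adj]
    (Δ : Fin N → ℝ) (U₀ Ω : ℝ) : (blockadeH G Δ U₀ Ω).IsHermitian := by
  ext n n'
  rcases eq_or_ne n n' with rfl | h
  · simp
  · simp [blockadeH, h, h.symm, hammingDist_comm n n']

theorem blockadeH_sub_smul_one_apply_of_ne {N : ℕ} (G : SimpleGraph (Fin N))
    [DecidableRel G.Adj] (Δ : Fin N → ℝ) (U₀ Ω μ : ℝ) {n n' : Fin N → Bool} (h : n ≠ n') :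
    (blockadeH G Δ U₀ Ω - μ • (1 : Matrix (Fin N → Bool) (Fin N → Bool) ℝ)) n n' =
      if hammingDist n n' = 1 then Ω else 0 := by
  simp [blockadeH, h]

/-- If `Ω ≠ 0`, the eigenspace of the blockade Hamiltonian `H(Ω)` for its minimal eigenvalue
is one-dimensional: the ground state is unique up to scalar multiples. -/
theorem blockadeH_ground_state_unique {N : ℕ} (G : SimpleGraph (Fin N)) [DecidableRel G.Adj]
    (Δ : Fin N → ℝ) (U₀ Ω : ℝ) (hΩ : Ω ≠ 0) (μ : ℝ)
    (hμ : Module.End.HasEigenvalue (Matrix.toLin' (blockadeH G Δ U₀ Ω)) μ)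
    (hmin : ∀ μ' : ℝ, Module.End.HasEigenvalue (Matrix.toLin' (blockadeH G Δ U₀ Ω)) μ' → μ ≤ μ') :
    Module.finrank ℝ (Module.End.eigenspace (Matrix.toLin' (blockadeH G Δ U₀ Ω)) μ) = 1 := by
  have hpsd := (blockadeH_isHermitian G Δ U₀ Ω).posSemidef_sub_smul_one hmin
  obtain ⟨c, hc, hcΩ⟩ : ∃ c : ℝ, c * c = 1 ∧ c * Ω ≤ 0 := by
    rcases le_total Ω 0 with h | h
    · exact ⟨1, by norm_num, by simpa using h⟩
    · exact ⟨-1, by norm_num, by simpa using h⟩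
  have hzero : ∀ x ∈ Module.End.eigenspace (Matrix.toLin' (blockadeH G Δ U₀ Ω)) μ,
      ∀ n, x n = 0 → x = 0 := by
    intro x hx n hn
    refine hpsd.eq_zero_of_mulVec_eq_zero (excitationSign_mul_self hc) ?_ ?_ ?_ hn
    · intro m m' hm
      rw [blockadeH_sub_smul_one_apply_of_ne G Δ U₀ Ω μ hm]
      split_ifs with hd
      · rwa [mul_right_comm, excitationSign_mul_of_hammingDist_eq_one hc hd]
      · simp
    · refine Relation.reflTransGen_of_update fun m i b hb => ?_
      have hd := hammingDist_update_of_ne m hb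
      rw [blockadeH_sub_smul_one_apply_of_ne G Δ U₀ Ω μ
        (hammingDist_ne_zero.1 (by rw [hd]; exact one_ne_zero)), if_pos hd]
      exact hΩ
    · rw [Module.End.mem_eigenspace_iff, Matrix.toLin'_apply] at hx
      rw [Matrix.sub_mulVec, hx, Matrix.smul_mulVec, Matrix.one_mulVec, sub_self]
  obtain ⟨v, hv, hv0⟩ := hμ.exists_hasEigenvector
  have hvn : v (fun _ => false) ≠ 0 := fun h => hv0 (hzero v hv _ h)
  refine (finrank_eq_one_iff_of_nonzero' (⟨v, hv⟩ : Module.End.eigenspace _ μ)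
    (by simpa using hv0)).2 fun ⟨x, hx⟩ => ⟨x (fun _ => false) / v (fun _ => false), ?_⟩
  have := hzero _ (Submodule.sub_mem _ (Submodule.smul_mem _
    (x (fun _ => false) / v (fun _ => false)) hv) hx) (fun _ => false) (by simp [hvn])
  exact Subtype.ext (sub_eq_zero.1 this)
end

section
/- If Ω > 0, then every eigenvector v of the blockade Hamiltonian H(Ω) for its minimal eigenvalue can be rescaled by a nonzero scalar so that its entries take the form v_n = (−1)^{δ(n)} c_n with c_n > 0 for every configuration n, where δ(n) = Σ_i n_i is the number of excited atoms in n; in particular, every entry of a ground eigenvector is nonzero. -/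
/-- The number of excited atoms in configuration `n`. -/
def numExcited {N : ℕ} (n : Fin N → Bool) : ℕ :=
  (Finset.univ.filter fun i => n i = true).card

theorem neg_one_pow_numExcited_mul {N : ℕ} (n m : Fin N → Bool) :
    (-1 : ℝ) ^ numExcited n * (-1 : ℝ) ^ numExcited m = (-1) ^ hammingDist n m := by
  have h (p : Fin N → Prop) [DecidablePred p] :
      (-1 : ℝ) ^ (Finset.univ.filter p).card = ∏ i, if p i then (-1 : ℝ) else 1 := by
    simp [Finset.prod_ite]
  rw [numExcited, numExcited, hammingDist, h, h, h, ← Finset.prod_mul_distrib]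
  refine Finset.prod_congr rfl fun i _ => ?_
  cases n i <;> cases m i <;> simp

/-- A property of configurations that is preserved by single flips is shared by all of them. -/
theorem forall_of_hammingDist_eq_one {ι : Type*} [Fintype ι] [DecidableEq ι] {P : (ι → Bool) → Prop}
    (hP : ∀ n m : ι → Bool, hammingDist n m = 1 → P n → P m) {n₀ : ι → Bool} (h₀ : P n₀)
    (n : ι → Bool) : P n := by
  have key (S : Finset ι) : P (S.piecewise n n₀) := by
    induction S using Finset.induction_on with
    | empty => simpa using h₀
    | insert i S hi ih =>
      rw [Finset.piecewise_insert]
      by_cases h : n i = S.piecewise n n₀ i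
      · rwa [h, Function.update_eq_self]
      · refine hP _ _ ?_ ih
        rw [hammingDist, Finset.card_eq_one]
        refine ⟨i, ?_⟩
        ext j
        by_cases hj : j = i
        · subst hj
          simpa using Ne.symm h
        · simp [hj]
  simpa using key Finset.univ

namespace Matrix

variable {ι : Type*} [Fintype ι]

/-- A real symmetric matrix minus a lower bound of its eigenvalues is positive semidefinite. -/
theorem IsHermitian.posSemidef_sub_smul_one_s3 [DecidableEq ι] {A : Matrix ι ι ℝ}
    (hA : A.IsHermitian) {μ : ℝ}
    (hμ : ∀ μ' : ℝ, Module.End.HasEigenvalue (Matrix.toLin' A) μ' → μ ≤ μ') :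
    (A - μ • (1 : Matrix ι ι ℝ)).PosSemidef := by
  have hB : (A - μ • (1 : Matrix ι ι ℝ)).IsHermitian := by
    refine hA.sub ?_
    simp [IsHermitian]
  rw [hB.posSemidef_iff_eigenvalues_nonneg]
  intro i
  have h := hB.mulVec_eigenvectorBasis i
  rw [sub_mulVec, smul_mulVec, one_mulVec, sub_eq_iff_eq_add, ← add_smul] at h
  have hne : (hB.eigenvectorBasis i).ofLp ≠ 0 := fun h0 =>
    hB.eigenvectorBasis.orthonormal.ne_zero i (by ext j; simpa using congrFun h0 j)
  have := hμ _ (Module.End.hasEigenvalue_of_hasEigenvector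
    (Module.End.hasEigenvector_iff.mpr
      ⟨Module.End.mem_eigenspace_iff.mpr (by rw [toLin'_apply]; exact h), hne⟩))
  simpa using this

/-- For a positive semidefinite matrix with nonpositive off-diagonal entries, the entrywise
absolute value of a null vector is a null vector. -/
theorem PosSemidef.mulVec_abs_eq_zero {A : Matrix ι ι ℝ} (hA : A.PosSemidef)
    (hoff : ∀ i j, i ≠ j → A i j ≤ 0) {x : ι → ℝ} (hx : A *ᵥ x = 0) :
    A *ᵥ (fun i => |x i|) = 0 := by
  rw [← hA.dotProduct_mulVec_zero_iff]
  refine le_antisymm ?_ (hA.dotProduct_mulVec_nonneg _)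
  have h0 : x ⬝ᵥ A *ᵥ x = 0 := by rw [hx, dotProduct_zero]
  rw [← h0]
  simp only [dotProduct, mulVec, Finset.mul_sum, Pi.star_apply, star_trivial]
  refine Finset.sum_le_sum fun i _ => Finset.sum_le_sum fun j _ => ?_
  by_cases hij : i = j
  · subst hij
    have := abs_mul_abs_self (x i)
    exact le_of_eq (by linear_combination A i i * this)
  · have h1 := le_abs_self (x i * x j)
    rw [abs_mul] at h1
    nlinarith [mul_le_mul_of_nonpos_left h1 (hoff i j hij)]

/-- For a matrix with nonpositive off-diagonal entries, zeros of a nonnegative null vector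
propagate along nonzero off-diagonal entries. -/
theorem eq_zero_of_mulVec_eq_zero_of_neg {A : Matrix ι ι ℝ}
    (hoff : ∀ i j, i ≠ j → A i j ≤ 0) {y : ι → ℝ} (hy : A *ᵥ y = 0) (hnonneg : ∀ i, 0 ≤ y i)
    {i j : ι} (hij : A i j < 0) (hi : y i = 0) : y j = 0 := by
  have h : ∑ k, A i k * y k = 0 := congrFun hy i
  have hle : ∀ k ∈ Finset.univ, A i k * y k ≤ 0 := fun k _ => by
    by_cases hk : i = k
    · rw [← hk, hi, mul_zero]
    · exact mul_nonpos_of_nonpos_of_nonneg (hoff i k hk) (hnonneg k)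
  have := (Finset.sum_eq_zero_iff_of_nonpos hle).mp h j (Finset.mem_univ j)
  exact (mul_eq_zero.mp this).resolve_left hij.ne

end Matrix

/-- A nonzero null vector of a positive semidefinite matrix indexed by configurations, whose
off-diagonal entries are nonpositive and negative between configurations differing by one flip,
has entries of one strict sign. -/
theorem Matrix.PosSemidef.pos_or_neg_of_mulVec_eq_zero {ι : Type*} [Fintype ι] [DecidableEq ι]
    {A : Matrix (ι → Bool) (ι → Bool) ℝ} (hA : A.PosSemidef)
    (hoff : ∀ n m, n ≠ m → A n m ≤ 0) (hflip : ∀ n m, hammingDist n m = 1 → A n m < 0)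
    {x : (ι → Bool) → ℝ} (hx0 : x ≠ 0) (hx : A.mulVec x = 0) :
    (∀ n, 0 < x n) ∨ ∀ n, x n < 0 := by
  have habs := hA.mulVec_abs_eq_zero hoff hx
  have key {y : (ι → Bool) → ℝ} (hy : A.mulVec y = 0) (hnonneg : ∀ n, 0 ≤ y n)
      {n₀ : ι → Bool} (h₀ : y n₀ = 0) (n : ι → Bool) : y n = 0 :=
    forall_of_hammingDist_eq_one (P := fun n => y n = 0)
      (fun n m h => eq_zero_of_mulVec_eq_zero_of_neg hoff hy hnonneg (hflip n m h)) h₀ n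
  have hne (n : ι → Bool) : x n ≠ 0 := fun h =>
    hx0 (funext fun m => abs_eq_zero.mp (key habs (fun _ => abs_nonneg _) (n₀ := n) (by simp [h]) m))
  have hsum : A.mulVec ((fun n => |x n|) + x) = 0 := by rw [mulVec_add, habs, hx, add_zero]
  have hnonneg (n : ι → Bool) : 0 ≤ |x n| + x n := by linarith [neg_abs_le (x n)]
  by_cases h : ∃ n, x n < 0
  · obtain ⟨n₀, h₀⟩ := h
    refine Or.inr fun n => lt_of_le_of_ne ?_ (hne n)
    have : |x n| + x n = 0 := key hsum hnonneg (n₀ := n₀) (by simp [abs_of_neg h₀]) n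
    linarith [abs_nonneg (x n)]
  · push Not at h
    exact Or.inl fun n => lt_of_le_of_ne (h n) (hne n).symm

/-- If `Ω > 0`, every ground eigenvector `v` of `H(Ω)` can be rescaled by a nonzero scalar
so that its entries have the form `(−1)^{δ(n)} c_n` with `c_n > 0`; in particular every entry
of a ground eigenvector is nonzero. -/
theorem blockadeH_ground_state_sign_structure {N : ℕ} (G : SimpleGraph (Fin N))
    [DecidableRel G.Adj] (Δ : Fin N → ℝ) (U₀ Ω : ℝ) (hΩ : 0 < Ω) (μ : ℝ)
    (hmin : ∀ μ' : ℝ,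
      Module.End.HasEigenvalue (Matrix.toLin' (blockadeH G Δ U₀ Ω)) μ' → μ ≤ μ')
    (v : (Fin N → Bool) → ℝ) (hv : v ≠ 0)
    (heig : (blockadeH G Δ U₀ Ω).mulVec v = μ • v) :
    (∃ t : ℝ, t ≠ 0 ∧ ∀ n : Fin N → Bool,
      0 < (-1 : ℝ) ^ (numExcited n) * (t * v n)) ∧
    ∀ n : Fin N → Bool, v n ≠ 0 := by
  set s : (Fin N → Bool) → ℝ := fun n => (-1) ^ numExcited n with hs
  have hss (n : Fin N → Bool) : s n * s n = 1 := by
    simp [hs, neg_one_pow_numExcited_mul]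
  set A := blockadeH G Δ U₀ Ω - μ • (1 : Matrix (Fin N → Bool) (Fin N → Bool) ℝ) with hA
  have hApsd : A.PosSemidef := (blockadeH_isHermitian G Δ U₀ Ω).posSemidef_sub_smul_one_s3 hmin
  have hAv : A.mulVec v = 0 := by
    rw [hA, Matrix.sub_mulVec, Matrix.smul_mulVec, Matrix.one_mulVec, heig, sub_self]
  set D := Matrix.diagonal s with hD
  have hBpsd : (D * A * D).PosSemidef := by
    simpa [hD] using hApsd.conjTranspose_mul_mul_same D
  have hBoff (n m : Fin N → Bool) (h : n ≠ m) :
      (D * A * D) n m = if hammingDist n m = 1 then -Ω else 0 := by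
    have hAnm : A n m = if hammingDist n m = 1 then Ω else 0 := by
      simp [hA, blockadeH, h]
    rw [hD, Matrix.mul_diagonal, Matrix.diagonal_mul, hAnm]
    split_ifs with h1
    · have := neg_one_pow_numExcited_mul n m
      rw [h1, pow_one] at this
      linear_combination Ω * this
    · simp
  have hDv : D.mulVec (fun n => s n * v n) = v := by
    ext n
    rw [hD, Matrix.mulVec_diagonal, ← mul_assoc, hss, one_mul]
  have hsigns := hBpsd.pos_or_neg_of_mulVec_eq_zero (x := fun n => s n * v n)
    (fun n m h => by rw [hBoff n m h]; split_ifs <;> linarith)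
    (fun n m h => by
      have hne : n ≠ m := by rintro rfl; simp at h
      rw [hBoff n m hne, if_pos h]; linarith)
    (fun h => hv (by rw [← hDv, h, Matrix.mulVec_zero]))
    (by rw [← Matrix.mulVec_mulVec, hDv, ← Matrix.mulVec_mulVec, hAv, Matrix.mulVec_zero])
  rcases hsigns with h | h
  · exact ⟨⟨1, one_ne_zero, fun n => by simpa using h n⟩,
      fun n h0 => by simpa [h0] using h n⟩
  · refine ⟨⟨-1, by norm_num, fun n => ?_⟩, fun n h0 => by simpa [h0] using h n⟩
    have : s n * v n < 0 := h n
    have : 0 < s n * (-1 * v n) := by linarith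
    exact this
end

section
/- Let H'(t) be the hopping matrix indexed by configurations whose entry between configurations n and n' equals −t if there is an edge {i,j} of G with n_i = 1, n_j = 0, n'_i = 0, n'_j = 1 and n_k = n'_k for all k ∉ {i,j}, and 0 otherwise. If Ω > 0 and t > 0, then the eigenspace of H(Ω) + H'(t) for its minimal eigenvalue is one-dimensional, and every entry of the corresponding ground eigenvector is nonzero. -/
/-- Two configurations are related by a single hop: an excitation moves from `i` to `j`
along an edge `{i,j}` of `G`, all other components being equal. -/
def HopRel {N : ℕ} (G : SimpleGraph (Fin N)) (n n' : Fin N → Bool) : Prop :=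
  ∃ i j : Fin N, G.Adj i j ∧ n i = true ∧ n j = false ∧ n' i = false ∧ n' j = true ∧
    ∀ k : Fin N, k ≠ i → k ≠ j → n k = n' k

instance {N : ℕ} (G : SimpleGraph (Fin N)) [DecidableRel G.Adj] (n n' : Fin N → Bool) :
    Decidable (HopRel G n n') :=
  inferInstanceAs (Decidable (∃ i j : Fin N,
    G.Adj i j ∧ n i = true ∧ n j = false ∧ n' i = false ∧ n' j = true ∧
      ∀ k : Fin N, k ≠ i → k ≠ j → n k = n' k))

/-- The hopping matrix `H'(t)`: entry `−t` between configurations related by a hop,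
`0` otherwise. -/
noncomputable def hopH {N : ℕ} (G : SimpleGraph (Fin N)) [DecidableRel G.Adj] (t : ℝ) :
    Matrix (Fin N → Bool) (Fin N → Bool) ℝ :=
  Matrix.of fun n n' => if HopRel G n n' then -t else 0

open Matrix in
/-- Perron–Frobenius argument: suppose the off-diagonal entries of a symmetric matrix become
nonpositive after conjugation by a diagonal matrix of signs. Then the zero set of an eigenvector
for the smallest eigenvalue is closed under the adjacency relation of the matrix. -/
theorem Matrix.IsHermitian.eq_zero_of_ground_state {ι : Type*} [Fintype ι] [DecidableEq ι]
    {A : Matrix ι ι ℝ} (hA : A.IsHermitian) {μ : ℝ}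
    (hmin : ∀ μ' : ℝ, Module.End.HasEigenvalue (Matrix.toLin' A) μ' → μ ≤ μ')
    {s : ι → ℝ} (hs : ∀ i, s i * s i = 1) (hoff : ∀ i j, i ≠ j → s i * s j * A i j ≤ 0)
    {v : ι → ℝ} (hv : A.mulVec v = μ • v) {i j : ι} (hi : v i = 0) (hij : A i j ≠ 0) :
    v j = 0 := by
  have hpsd := hA.posSemidef_sub_smul_one hmin
  set B := A - μ • (1 : Matrix ι ι ℝ) with hB
  have hBoff : ∀ i j, i ≠ j → B i j = A i j := fun i j h => by simp [hB, h]
  have habs : ∀ i, |s i| = 1 := fun i => by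
    rcases mul_self_eq_one_iff.mp (hs i) with h | h <;> simp [h]
  have hBv : B.mulVec v = 0 := by
    rw [hB, Matrix.sub_mulVec, Matrix.smul_mulVec, Matrix.one_mulVec, hv, sub_self]
  let u : ι → ℝ := fun i => s i * |v i|
  have hle : u ⬝ᵥ B.mulVec u ≤ v ⬝ᵥ B.mulVec v := by
    simp only [dotProduct, mulVec, Finset.mul_sum]
    refine Finset.sum_le_sum fun a _ => Finset.sum_le_sum fun b _ => ?_
    by_cases hab : a = b
    · subst hab
      refine le_of_eq ?_
      calc u a * (B a a * u a) = (s a * s a) * B a a * (|v a| * |v a|) := by simp only [u]; ring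
        _ = v a * (B a a * v a) := by rw [hs, abs_mul_abs_self]; ring
    · have h1 : s a * s b * A a b = -|A a b| := by
        have := abs_of_nonpos (hoff a b hab)
        rw [abs_mul, abs_mul, habs, habs, one_mul, one_mul] at this
        linarith
      rw [hBoff a b hab]
      calc u a * (A a b * u b) = (s a * s b * A a b) * (|v a| * |v b|) := by simp only [u]; ring
        _ = -|v a * (A a b * v b)| := by rw [h1, abs_mul, abs_mul]; ring
        _ ≤ _ := neg_abs_le _
  rw [hBv, dotProduct_zero] at hle
  have hBu : B.mulVec u = 0 := by
    have h0 := hpsd.dotProduct_mulVec_nonneg u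
    rw [star_trivial] at h0
    refine (hpsd.dotProduct_mulVec_zero_iff u).mp ?_
    rw [star_trivial]
    exact le_antisymm hle h0
  by_cases hne : i = j
  · rwa [← hne]
  have hsum : ∑ k, s i * s k * B i k * |v k| = 0 := by
    have := congrArg (s i * ·) (congrFun hBu i)
    simp only [mulVec, dotProduct, Finset.mul_sum, Pi.zero_apply, mul_zero] at this
    rw [← this]
    exact Finset.sum_congr rfl fun k _ => by simp only [u]; ring
  have hterm := (Finset.sum_eq_zero_iff_of_nonpos (fun k _ => by
    by_cases hik : i = k
    · rw [← hik, hi, abs_zero, mul_zero]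
    · rw [hBoff i k hik]
      exact mul_nonpos_of_nonpos_of_nonneg (hoff i k hik) (abs_nonneg _))).mp hsum j
    (Finset.mem_univ j)
  have hs0 : ∀ k, s k ≠ 0 := fun k hk => by simpa [hk] using hs k
  rw [hBoff i j hne] at hterm
  simpa [hs0, hij] using hterm

/-- If no eigenvector for an eigenvalue has a vanishing entry, the eigenvalue is simple. -/
theorem Module.End.finrank_eigenspace_eq_one_of_forall_ne_zero {K ι : Type*} [Field K]
    {f : Module.End K (ι → K)} {μ : K} (hμ : f.HasEigenvalue μ) (i : ι)
    (h : ∀ v, f.HasEigenvector μ v → v i ≠ 0) :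
    Module.finrank K (f.eigenspace μ) = 1 := by
  obtain ⟨v, hv⟩ := hμ.exists_hasEigenvector
  refine finrank_eq_one (⟨v, hv.1⟩ : f.eigenspace μ) (by simpa using hv.2) fun w => ?_
  refine ⟨w.1 i / v i, Subtype.ext ?_⟩
  by_contra hne
  refine h ((w.1 i / v i) • v - w.1)
    ⟨Submodule.sub_mem _ (Submodule.smul_mem _ _ hv.1) w.2, sub_ne_zero.mpr hne⟩ ?_
  simp [div_mul_cancel₀ _ (h v hv)]

/-- The parity sign `(-1)^|n|` of a configuration. -/
def configSign {N : ℕ} (n : Fin N → Bool) : ℝ :=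
  ∏ i, if n i = true then -1 else 1

theorem configSign_mul_self {N : ℕ} (n : Fin N → Bool) : configSign n * configSign n = 1 := by
  rw [configSign, ← Finset.prod_mul_distrib]
  exact Finset.prod_eq_one fun i _ => by split_ifs <;> norm_num

theorem configSign_update {N : ℕ} {n : Fin N → Bool} {i : Fin N} {b : Bool} (h : n i ≠ b) :
    configSign (Function.update n i b) = -configSign n := by
  unfold configSign
  rw [← Finset.mul_prod_erase _ _ (Finset.mem_univ i),
    ← Finset.mul_prod_erase _ (fun k => if n k = true then (-1 : ℝ) else 1)
      (h := Finset.mem_univ i), ← neg_mul]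
  congr 1
  · cases hn : n i <;> cases b <;> simp_all
  · exact Finset.prod_congr rfl fun k hk => by
      rw [Function.update_of_ne (Finset.ne_of_mem_erase hk)]

theorem hammingDist_eq_one_iff_exists_update {ι : Type*} [Fintype ι] [DecidableEq ι]
    {β : Type*} [DecidableEq β] {x y : ι → β} :
    hammingDist x y = 1 ↔ ∃ i b, x i ≠ b ∧ y = Function.update x i b := by
  rw [hammingDist, Finset.card_eq_one]
  constructor
  · rintro ⟨i, hi⟩
    have hmem : ∀ k, x k ≠ y k ↔ k = i := fun k => by
      simpa using Finset.ext_iff.mp hi k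
    refine ⟨i, y i, (hmem i).mpr rfl, ?_⟩
    rw [Function.eq_update_iff]
    exact ⟨rfl, fun k hk => (not_not.mp (mt (hmem k).mp hk)).symm⟩
  · rintro ⟨i, b, hb, rfl⟩
    refine ⟨i, ?_⟩
    ext k
    by_cases hk : k = i
    · subst hk; simpa using hb
    · simp [hk]

theorem configSign_mul_of_hammingDist_eq_one {N : ℕ} {n n' : Fin N → Bool}
    (h : hammingDist n n' = 1) : configSign n * configSign n' = -1 := by
  obtain ⟨i, b, hb, rfl⟩ := hammingDist_eq_one_iff_exists_update.mp h
  rw [configSign_update hb, mul_neg, configSign_mul_self]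

theorem HopRel.symm {N : ℕ} {G : SimpleGraph (Fin N)} {n n' : Fin N → Bool}
    (h : HopRel G n n') : HopRel G n' n := by
  obtain ⟨i, j, hij, h1, h2, h3, h4, hk⟩ := h
  exact ⟨j, i, hij.symm, h4, h3, h2, h1, fun k hj hi => (hk k hi hj).symm⟩

theorem HopRel.configSign_mul {N : ℕ} {G : SimpleGraph (Fin N)} {n n' : Fin N → Bool}
    (h : HopRel G n n') : configSign n * configSign n' = 1 := by
  obtain ⟨i, j, hij, h1, h2, h3, h4, hk⟩ := h
  have : n' = Function.update (Function.update n i false) j true := by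
    rw [Function.eq_update_iff]
    refine ⟨h4, fun k hj => ?_⟩
    by_cases hi : k = i
    · rw [hi, h3, Function.update_self]
    · rw [Function.update_of_ne hi, hk k hi hj]
  rw [this, configSign_update, configSign_update, neg_neg, configSign_mul_self]
  · simp [h1]
  · simp [Function.update_of_ne hij.ne', h2]

/-- A set of configurations that is nonempty and closed under changing one component contains
every configuration. -/
theorem forall_of_hammingDist_eq_one_s7 {ι : Type*} [Fintype ι] [DecidableEq ι]
    {β : Type*} [DecidableEq β] {p : (ι → β) → Prop}
    (hp : ∀ x y, hammingDist x y = 1 → p x → p y) {x : ι → β} (hx : p x) (y : ι → β) : p y := by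
  have key : ∀ T : Finset ι, p (T.piecewise y x) := fun T => by
    induction T using Finset.induction_on with
    | empty => simpa using hx
    | insert i T _ ih =>
      rw [Finset.piecewise_insert]
      by_cases h : T.piecewise y x i = y i
      · rwa [← h, Function.update_eq_self]
      · exact hp _ _ (hammingDist_eq_one_iff_exists_update.mpr ⟨i, y i, h, rfl⟩) ih
  simpa using key Finset.univ

theorem blockadeH_add_hopH_isHermitian {N : ℕ} (G : SimpleGraph (Fin N)) [DecidableRel G.Adj]
    (Δ : Fin N → ℝ) (U₀ Ω t : ℝ) : (blockadeH G Δ U₀ Ω + hopH G t).IsHermitian := by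
  refine Matrix.IsHermitian.ext fun n n' => ?_
  have hhop : HopRel G n' n ↔ HopRel G n n' := ⟨HopRel.symm, HopRel.symm⟩
  by_cases h : n = n'
  · subst h; simp
  · simp [blockadeH, hopH, h, Ne.symm h, hhop, hammingDist_comm n' n]

theorem configSign_mul_blockadeH_add_hopH_nonpos {N : ℕ} (G : SimpleGraph (Fin N))
    [DecidableRel G.Adj] (Δ : Fin N → ℝ) (U₀ : ℝ) {Ω t : ℝ} (hΩ : 0 ≤ Ω) (ht : 0 ≤ t)
    {n n' : Fin N → Bool} (h : n ≠ n') :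
    configSign n * configSign n' * (blockadeH G Δ U₀ Ω + hopH G t) n n' ≤ 0 := by
  simp only [blockadeH, hopH, Matrix.add_apply, Matrix.of_apply, if_neg h]
  by_cases h1 : hammingDist n n' = 1 <;> by_cases h2 : HopRel G n n'
  · linarith [configSign_mul_of_hammingDist_eq_one h1, h2.configSign_mul]
  · simpa [h1, h2, configSign_mul_of_hammingDist_eq_one h1] using hΩ
  · simpa [h1, h2, h2.configSign_mul] using ht
  · simp [h1, h2]

theorem blockadeH_add_hopH_apply_of_hammingDist_eq_one {N : ℕ} (G : SimpleGraph (Fin N))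
    [DecidableRel G.Adj] (Δ : Fin N → ℝ) (U₀ Ω t : ℝ) {n n' : Fin N → Bool}
    (h : hammingDist n n' = 1) : (blockadeH G Δ U₀ Ω + hopH G t) n n' = Ω := by
  have hne : n ≠ n' := by rintro rfl; simp at h
  have hhop : ¬HopRel G n n' := fun h2 => by
    linarith [configSign_mul_of_hammingDist_eq_one h, h2.configSign_mul]
  simp [blockadeH, hopH, hne, h, hhop]

/-- If `Ω > 0` and `t > 0`, the eigenspace of `H(Ω) + H'(t)` for its minimal eigenvalue is
one-dimensional, and every entry of the corresponding ground eigenvector is nonzero. -/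
theorem blockadeH_hop_ground_state_unique {N : ℕ} (G : SimpleGraph (Fin N))
    [DecidableRel G.Adj] (Δ : Fin N → ℝ) (U₀ Ω t : ℝ) (hΩ : 0 < Ω) (ht : 0 < t) (μ : ℝ)
    (hμ : Module.End.HasEigenvalue
      (Matrix.toLin' (blockadeH G Δ U₀ Ω + hopH G t)) μ)
    (hmin : ∀ μ' : ℝ, Module.End.HasEigenvalue
      (Matrix.toLin' (blockadeH G Δ U₀ Ω + hopH G t)) μ' → μ ≤ μ') :
    Module.finrank ℝ
      (Module.End.eigenspace (Matrix.toLin' (blockadeH G Δ U₀ Ω + hopH G t)) μ) = 1 ∧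
    ∀ v : (Fin N → Bool) → ℝ, v ≠ 0 →
      (blockadeH G Δ U₀ Ω + hopH G t).mulVec v = μ • v →
      ∀ n : Fin N → Bool, v n ≠ 0 := by
  have hA := blockadeH_add_hopH_isHermitian G Δ U₀ Ω t
  have hne : ∀ v : (Fin N → Bool) → ℝ, v ≠ 0 →
      (blockadeH G Δ U₀ Ω + hopH G t).mulVec v = μ • v → ∀ n, v n ≠ 0 := by
    intro v hv0 hv n hn
    refine hv0 (funext (forall_of_hammingDist_eq_one_s7 (p := fun m => v m = 0) ?_ hn))
    intro x y hxy hx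
    refine hA.eq_zero_of_ground_state hmin configSign_mul_self
      (fun _ _ => configSign_mul_blockadeH_add_hopH_nonpos G Δ U₀ hΩ.le ht.le) hv hx ?_
    rw [blockadeH_add_hopH_apply_of_hammingDist_eq_one G Δ U₀ Ω t hxy]
    exact hΩ.ne'
  refine ⟨Module.End.finrank_eigenspace_eq_one_of_forall_ne_zero hμ (fun _ => false)
    fun v hv => hne v hv.2 ?_ _, hne⟩
  rw [← Matrix.toLin'_apply]
  exact hv.apply_eq_smul
end
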